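/- arXiv:2103.06680 — 3 statements merged into one kernel-verified Lean document; each statement's English description precedes it below -/
import Mathlib

section
/- Let λ, μ, ν > 0 and let z ≥ 0. Then ∫_0^∞ e^{−z t} (μ + λ(1 − e^{−ν t})) · exp( (λ/ν)(1 − e^{−ν t}) − (λ + μ) t ) dt = 1 − z e^{λ/ν} ∑_{n=0}^{∞} (−1)^n (λ/ν)^n / ( n! (λ + μ + z + nν) ). (This is the moment generating function Ψ(z) = E[e^{−zT}] of the Poisson-modulated exponential distribution PoExp(λ, (μ + nν)_{n≥0}).) -/
open MeasureTheory

theorem integrableOn_exp_mul_exp_sub {a ν : ℝ} (ha : 0 < a) (hν : 0 ≤ ν) (d : ℝ) :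
    IntegrableOn (fun t : ℝ => Real.exp (d * Real.exp (-ν * t) - a * t)) (Set.Ioi 0) := by
  have hg := (integrableOn_exp_mul_Ioi (neg_lt_zero.mpr ha) 0).const_mul (Real.exp |d|)
  refine Integrable.mono' hg (by fun_prop) ?_
  filter_upwards [self_mem_ae_restrict measurableSet_Ioi] with t ht
  have ht : 0 < t := ht
  have h1 : Real.exp (-ν * t) ≤ 1 := Real.exp_le_one_iff.mpr (by nlinarith)
  rw [Real.norm_of_nonneg (Real.exp_pos _).le, ← Real.exp_add, Real.exp_le_exp]
  have h2 : d * Real.exp (-ν * t) ≤ |d| * 1 :=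
    mul_le_mul (le_abs_self d) h1 (Real.exp_pos _).le (abs_nonneg d)
  linarith

theorem hasSum_integral_exp_mul_exp_sub {a ν : ℝ} (ha : 0 < a) (hν : 0 ≤ ν) (d : ℝ) :
    HasSum (fun n : ℕ => d ^ n / (n.factorial * (a + n * ν)))
      (∫ t in Set.Ioi (0 : ℝ), Real.exp (d * Real.exp (-ν * t) - a * t)) := by
  have hpos (n : ℕ) : 0 < a + n * ν := by positivity
  have hneg (n : ℕ) : -(a + n * ν) < 0 := neg_lt_zero.mpr (hpos n)
  have hint (e : ℝ) (n : ℕ) :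
      ∫ t in Set.Ioi (0 : ℝ), e ^ n / n.factorial * Real.exp (-(a + n * ν) * t)
        = e ^ n / (n.factorial * (a + n * ν)) := by
    rw [integral_const_mul, integral_exp_mul_Ioi (hneg n)]
    have := (hpos n).ne'
    simp only [mul_zero, Real.exp_zero, neg_div_neg_eq]
    field_simp
  have key := hasSum_integral_of_summable_integral_norm
    (μ := volume.restrict (Set.Ioi (0 : ℝ)))
    (F := fun (n : ℕ) t => d ^ n / n.factorial * Real.exp (-(a + n * ν) * t))
    (fun n => (integrableOn_exp_mul_Ioi (hneg n) 0).const_mul _) ?_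
  · have hexp (t : ℝ) : ∑' n : ℕ, d ^ n / n.factorial * Real.exp (-(a + n * ν) * t)
        = Real.exp (d * Real.exp (-ν * t) - a * t) := by
      have h := (NormedSpace.expSeries_div_hasSum_exp (d * Real.exp (-ν * t))).mul_right
        (Real.exp (-a * t))
      rw [← Real.exp_eq_exp_ℝ, ← Real.exp_add] at h
      rw [sub_eq_add_neg, ← neg_mul, ← h.tsum_eq]
      refine tsum_congr fun n => ?_
      rw [mul_pow, ← Real.exp_nat_mul, mul_div_right_comm, mul_assoc, ← Real.exp_add]
      ring_nf
    simp only [hint, hexp] at key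
    exact key
  · have hnorm (n : ℕ) (t : ℝ) : ‖d ^ n / n.factorial * Real.exp (-(a + n * ν) * t)‖
        = |d| ^ n / n.factorial * Real.exp (-(a + n * ν) * t) := by
      simp
    simp only [hnorm, hint]
    refine Summable.of_nonneg_of_le (fun n => by have := hpos n; positivity) (fun n => ?_)
      ((Real.summable_pow_div_factorial |d|).div_const a)
    rw [div_div]
    gcongr
    have : 0 ≤ n * ν := by positivity
    linarith

theorem mgf_formula (lam mu ν : ℝ)
    (hlam : 0 < lam) (hmu : 0 < mu) (hν : 0 < ν) (z : ℝ) (hz : 0 ≤ z) :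
    ∫ t in Set.Ioi (0 : ℝ),
        Real.exp (-z * t) * (mu + lam * (1 - Real.exp (-ν * t))) *
          Real.exp ((lam / ν) * (1 - Real.exp (-ν * t)) - (lam + mu) * t)
      = 1 - z * Real.exp (lam / ν) *
          ∑' n : ℕ, (-1 : ℝ) ^ n * (lam / ν) ^ n / (n.factorial * (lam + mu + z + n * ν)) := by
  have ha : 0 < lam + mu + z := by positivity
  set E : ℝ → ℝ := fun t => Real.exp (-(lam / ν) * Real.exp (-ν * t) - (lam + mu + z) * t)
  have hE : IntegrableOn E (Set.Ioi 0) := integrableOn_exp_mul_exp_sub ha hν.le _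
  have hsum : ∑' n : ℕ, (-1 : ℝ) ^ n * (lam / ν) ^ n / (n.factorial * (lam + mu + z + n * ν))
      = ∫ t in Set.Ioi (0 : ℝ), E t := by
    simp only [← mul_pow, neg_one_mul]
    exact (hasSum_integral_exp_mul_exp_sub ha hν.le _).tsum_eq
  have hfac (t : ℝ) : Real.exp (-z * t) * (mu + lam * (1 - Real.exp (-ν * t))) *
      Real.exp ((lam / ν) * (1 - Real.exp (-ν * t)) - (lam + mu) * t)
      = Real.exp (lam / ν) * ((lam + mu + z - lam * Real.exp (-ν * t)) * E t)
        - z * Real.exp (lam / ν) * E t := by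
    have : Real.exp (-z * t) * Real.exp ((lam / ν) * (1 - Real.exp (-ν * t)) - (lam + mu) * t)
        = Real.exp (lam / ν) * E t := by
      simp only [E, ← Real.exp_add]
      ring_nf
    linear_combination (mu + lam * (1 - Real.exp (-ν * t))) * this
  have hderiv (t : ℝ) : HasDerivAt (fun t => -E t)
      ((lam + mu + z - lam * Real.exp (-ν * t)) * E t) t := by
    have h := (((((hasDerivAt_id t).const_mul (-ν)).exp.const_mul (-(lam / ν))).sub
      ((hasDerivAt_id t).const_mul (lam + mu + z))).exp).neg
    refine h.congr_deriv ?_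
    simp only [E, id, Pi.sub_apply]
    field_simp
    ring
  have hnonneg (t : ℝ) (ht : t ∈ Set.Ioi (0 : ℝ)) :
      0 ≤ (lam + mu + z - lam * Real.exp (-ν * t)) * E t := by
    have ht : 0 < t := ht
    have h1 : Real.exp (-ν * t) ≤ 1 := Real.exp_le_one_iff.mpr (by nlinarith)
    exact mul_nonneg (by nlinarith) (Real.exp_pos _).le
  have hlim : Filter.Tendsto (fun t => -E t) Filter.atTop (nhds 0) := by
    have h1 : Filter.Tendsto (fun t : ℝ => (lam + mu + z) * t) Filter.atTop Filter.atTop :=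
      Filter.tendsto_id.const_mul_atTop ha
    rw [← neg_zero]
    refine (squeeze_zero (fun t => (Real.exp_pos _).le) (fun t => ?_)
      (Real.tendsto_exp_neg_atTop_nhds_zero.comp h1)).neg
    refine Real.exp_le_exp.mpr ?_
    have : 0 ≤ lam / ν * Real.exp (-ν * t) := by positivity
    linarith
  have hD := integrableOn_Ioi_deriv_of_nonneg' (fun t _ => hderiv t) hnonneg hlim
  have hI := integral_Ioi_of_hasDerivAt_of_nonneg' (fun t _ => hderiv t) hnonneg hlim
  have hzero : Real.exp (lam / ν) * E 0 = 1 := by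
    simp [E, ← Real.exp_add]
  simp only [hfac]
  rw [integral_sub (hD.const_mul _) (hE.const_mul _), integral_const_mul, integral_const_mul, hI,
    hsum, zero_sub, neg_neg, hzero]
end

section
/- Let λ, μ, ν > 0 and define f(t) = (μ + λ(1 − e^{−ν t})) · exp( −(λ + μ) t + (λ/ν)(1 − e^{−ν t}) ) for t ≥ 0. If λν ≤ μ², then f is strictly decreasing on (0, ∞) (so its maximum over [0, ∞) is attained at t = 0). If λν > μ², then f is strictly increasing on (0, m) and strictly decreasing on (m, ∞), where m = (1/ν) · ln[ (λ/(λ+μ)) · ( 1 + ν/(2(λ+μ)) + √( (ν/(λ+μ)) (1 + ν/(4(λ+μ))) ) ) ] > 0; in particular f has a unique maximum at t = m. -/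
open Real Set

/-- Derivative of the Poisson-modulated exponential density with constant modulating rate. -/
lemma hasDerivAt_density {lam mu ν : ℝ} (hν : ν ≠ 0) (t : ℝ) :
    HasDerivAt (fun t => (mu + lam * (1 - exp (-ν * t))) *
        exp (-(lam + mu) * t + (lam / ν) * (1 - exp (-ν * t))))
      ((ν * (lam * exp (-ν * t)) - (lam + mu - lam * exp (-ν * t)) ^ 2) *
        exp (-(lam + mu) * t + (lam / ν) * (1 - exp (-ν * t)))) t := by
  have h_exp : HasDerivAt (fun t => 1 - exp (-ν * t)) (-(exp (-ν * t) * (-ν * 1))) t :=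
    (((hasDerivAt_id t).const_mul (-ν)).exp).const_sub 1
  have h_inner := ((hasDerivAt_id t).const_mul (-(lam + mu))).add (h_exp.const_mul (lam / ν))
  refine (((h_exp.const_mul lam).const_add mu).mul h_inner.exp).congr_deriv ?_
  simp only [id, Pi.add_apply]
  field_simp
  ring

/-- The larger root `R` of `(R - 1) ^ 2 = s * R`. -/
lemma sub_one_sq_eq_mul_of_eq_add_sqrt {s R : ℝ} (hs : 0 < s)
    (hR : R = 1 + s / 2 + √(s * (1 + s / 4))) : 1 < R ∧ (R - 1) ^ 2 = s * R := by
  have h_sqrt : √(s * (1 + s / 4)) ^ 2 = s * (1 + s / 4) := sq_sqrt (by positivity)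
  refine ⟨by rw [hR]; linarith [sqrt_nonneg (s * (1 + s / 4))], ?_⟩
  rw [← sub_eq_iff_eq_add'.mpr hR] at h_sqrt
  linarith

/-- The function `w ↦ ν * w - (a - w) ^ 2` is strictly increasing on `(-∞, a]`. -/
lemma mul_sub_sub_sq_lt {ν a v w : ℝ} (hν : 0 < ν) (hvw : v < w) (hwa : w ≤ a) :
    ν * v - (a - v) ^ 2 < ν * w - (a - w) ^ 2 := by
  nlinarith [mul_pos hν (sub_pos.mpr hvw), pow_le_pow_left₀ (sub_nonneg.mpr hwa)
    (sub_le_sub_left hvw.le a) 2]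


theorem density_unimodal (lam mu ν : ℝ)
    (hlam : 0 < lam) (hmu : 0 < mu) (hν : 0 < ν)
    (f : ℝ → ℝ)
    (hf : ∀ t, f t = (mu + lam * (1 - Real.exp (-ν * t))) *
      Real.exp (-(lam + mu) * t + (lam / ν) * (1 - Real.exp (-ν * t)))) :
    (lam * ν ≤ mu ^ 2 →
      StrictAntiOn f (Set.Ioi (0 : ℝ)) ∧ ∀ t ∈ Set.Ici (0 : ℝ), f t ≤ f 0) ∧
    (mu ^ 2 < lam * ν →
      ∀ m : ℝ,
        m = (1 / ν) * Real.log ((lam / (lam + mu)) *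
          (1 + ν / (2 * (lam + mu)) +
            Real.sqrt ((ν / (lam + mu)) * (1 + ν / (4 * (lam + mu)))))) →
        0 < m ∧ StrictMonoOn f (Set.Ioo (0 : ℝ) m) ∧ StrictAntiOn f (Set.Ioi m) ∧
          ∀ t ∈ Set.Ici (0 : ℝ), t ≠ m → f t < f m) := by
  have hderiv (t : ℝ) : HasDerivAt f
      ((ν * (lam * exp (-ν * t)) - (lam + mu - lam * exp (-ν * t)) ^ 2) *
        exp (-(lam + mu) * t + (lam / ν) * (1 - exp (-ν * t)))) t := by
    rw [funext hf]
    exact hasDerivAt_density hν.ne' t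
  have hcont : Continuous f := continuous_iff_continuousAt.mpr fun t => (hderiv t).continuousAt
  have hw {s t : ℝ} (hst : s < t) : lam * exp (-ν * t) < lam * exp (-ν * s) := by
    gcongr lam * exp ?_
    nlinarith
  have hw_le {t : ℝ} (ht : 0 ≤ t) : lam * exp (-ν * t) ≤ lam := by
    have : exp (-ν * t) ≤ 1 := exp_le_one_iff.mpr (by nlinarith)
    nlinarith
  have h_anti {c : ℝ} (hc : 0 ≤ c)
      (hcrit : ν * (lam * exp (-ν * c)) - (lam + mu - lam * exp (-ν * c)) ^ 2 ≤ 0) :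
      StrictAntiOn f (Ici c) := by
    refine strictAntiOn_of_deriv_neg (convex_Ici c) hcont.continuousOn fun t ht => ?_
    rw [interior_Ici] at ht
    rw [(hderiv t).deriv]
    refine mul_neg_of_neg_of_pos ?_ (exp_pos _)
    exact (mul_sub_sub_sq_lt hν (hw ht) (by linarith [hw_le hc])).trans_le hcrit
  refine ⟨fun h => ?_, fun h m hm => ?_⟩
  · have h0 : StrictAntiOn f (Ici 0) := h_anti le_rfl (by simpa [mul_comm ν] using h)
    exact ⟨h0.mono Ioi_subset_Ici_self, fun t ht => h0.antitoneOn self_mem_Ici ht ht⟩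
  · have ha : 0 < lam + mu := by positivity
    obtain ⟨hR_gt, hR⟩ := sub_one_sq_eq_mul_of_eq_add_sqrt (div_pos hν ha) rfl
    have hR_eq : 1 + ν / (2 * (lam + mu)) + √((ν / (lam + mu)) * (1 + ν / (4 * (lam + mu)))) =
        1 + ν / (lam + mu) / 2 + √(ν / (lam + mu) * (1 + ν / (lam + mu) / 4)) := by
      rw [div_div, div_div, mul_comm 2, mul_comm 4]
    rw [hR_eq] at hm
    clear hR_eq
    generalize 1 + ν / (lam + mu) / 2 + √(ν / (lam + mu) * (1 + ν / (lam + mu) / 4)) = R at hm hR hR_gt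
    have hR_pos : 0 < R := by linarith
    have hwm : lam * exp (-ν * m) = (lam + mu) / R := by
      have : -ν * m = -log (lam / (lam + mu) * R) := by rw [hm]; field_simp
      rw [this, exp_neg, exp_log (by positivity)]
      field_simp
    have hcrit : ν * (lam * exp (-ν * m)) - (lam + mu - lam * exp (-ν * m)) ^ 2 = 0 := by
      rw [hwm]
      field_simp at hR ⊢
      linear_combination -(lam + mu) * hR
    have hm_pos : 0 < m := by
      by_contra! hm_le
      have hle : lam ≤ lam * exp (-ν * m) :=
        le_mul_of_one_le_right hlam.le (one_le_exp (by nlinarith))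
      have hlt : lam * exp (-ν * m) < lam + mu := hwm ▸ div_lt_self ha hR_gt
      rcases hle.eq_or_lt with heq | hlt'
      · rw [← heq] at hcrit
        nlinarith
      · nlinarith [mul_sub_sub_sq_lt hν hlt' hlt.le]
    have h_anti_m : StrictAntiOn f (Ici m) := h_anti hm_pos.le hcrit.le
    have h_mono : StrictMonoOn f (Icc 0 m) := by
      refine strictMonoOn_of_deriv_pos (convex_Icc 0 m) hcont.continuousOn fun t ht => ?_
      rw [interior_Icc] at ht
      rw [(hderiv t).deriv]
      refine mul_pos ?_ (exp_pos _)
      exact hcrit ▸ mul_sub_sub_sq_lt hν (hw ht.2) (by linarith [hw_le ht.1.le])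
    refine ⟨hm_pos, h_mono.mono Ioo_subset_Icc_self, h_anti_m.mono Ioi_subset_Ici_self,
      fun t ht htm => ?_⟩
    rcases htm.lt_or_gt with hlt | hgt
    · exact h_mono ⟨ht, hlt.le⟩ (right_mem_Icc.mpr hm_pos.le) hlt
    · exact h_anti_m self_mem_Ici hgt.le hgt
end

section
/- Let λ, μ, ν > 0 and let m ≥ 1 be an integer. Then m ∫_0^∞ t^{m−1} exp( (λ/ν)(1 − e^{−ν t}) − (λ + μ) t ) dt = m! · e^{λ/ν} ∑_{n=0}^{∞} (−1)^n (λ/ν)^n / ( n! (λ + μ + nν)^m ). (This is the formula for the m-th moment E[T^m] of the Poisson-modulated exponential distribution PoExp(λ, (μ + nν)_{n≥0}).) -/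
open MeasureTheory

theorem integral_pow_mul_exp_neg_mul_Ioi {r : ℝ} (hr : 0 < r) (k : ℕ) :
    ∫ t in Set.Ioi (0 : ℝ), t ^ k * Real.exp (-(r * t)) = k.factorial / r ^ (k + 1) := by
  have h := Real.integral_rpow_mul_exp_neg_mul_Ioi
    (show (0 : ℝ) < (k : ℝ) + 1 by positivity) hr
  rw [Real.Gamma_nat_eq_factorial] at h
  simp only [add_sub_cancel_right, Real.rpow_natCast] at h
  rw [h, ← Nat.cast_succ, Real.rpow_natCast, one_div, inv_pow, div_eq_inv_mul]

theorem integrableOn_pow_mul_exp_neg_mul_Ioi {r : ℝ} (hr : 0 < r) (k : ℕ) :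
    IntegrableOn (fun t : ℝ => t ^ k * Real.exp (-(r * t))) (Set.Ioi 0) := by
  refine Integrable.of_integral_ne_zero ?_
  rw [integral_pow_mul_exp_neg_mul_Ioi hr k]
  positivity

theorem moments_linear_rates (lam mu ν : ℝ)
    (hlam : 0 < lam) (hmu : 0 < mu) (hν : 0 < ν) (m : ℕ) (hm : 1 ≤ m) :
    ∫ t in Set.Ioi (0 : ℝ),
        (m : ℝ) * t ^ (m - 1) *
          Real.exp ((lam / ν) * (1 - Real.exp (-ν * t)) - (lam + mu) * t)
      = (m.factorial : ℝ) * Real.exp (lam / ν) *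
          ∑' n : ℕ, (-1 : ℝ) ^ n * (lam / ν) ^ n /
            (n.factorial * (lam + mu + n * ν) ^ m) := by
  obtain ⟨k, rfl⟩ : ∃ k, m = k + 1 := ⟨m - 1, by omega⟩
  rw [Nat.add_sub_cancel]
  set a := lam / ν
  have ha : 0 < a := by positivity
  have hr : ∀ n : ℕ, 0 < lam + mu + n * ν := fun n => by positivity
  let c : ℕ → ℝ := fun n => Real.exp a * ((k + 1 : ℕ) : ℝ) * ((-a) ^ n / n.factorial)
  let F : ℕ → ℝ → ℝ := fun n t => c n * (t ^ k * Real.exp (-((lam + mu + n * ν) * t)))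
  have hF : ∀ n, Integrable (F n) (volume.restrict (Set.Ioi 0)) := fun n =>
    (integrableOn_pow_mul_exp_neg_mul_Ioi (hr n) k).const_mul (c n)
  have hnorm : ∀ n, ∫ t in Set.Ioi (0 : ℝ), ‖F n t‖ =
      |c n| * (k.factorial / (lam + mu + n * ν) ^ (k + 1)) := fun n => by
    rw [← integral_pow_mul_exp_neg_mul_Ioi (hr n) k, ← integral_const_mul]
    refine setIntegral_congr_fun measurableSet_Ioi fun t ht => ?_
    have ht : 0 < t := ht
    simp only [F, norm_mul, Real.norm_eq_abs, abs_pow, abs_of_pos ht, Real.abs_exp]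
  have habs : ∀ n, |c n| = Real.exp a * ((k + 1 : ℕ) : ℝ) * (a ^ n / n.factorial) := fun n => by
    simp only [c, abs_mul, abs_div, abs_pow, abs_neg, abs_of_pos ha, Real.abs_exp, Nat.abs_cast]
  have hsum : Summable fun n => ∫ t in Set.Ioi (0 : ℝ), ‖F n t‖ := by
    simp only [hnorm, habs]
    refine Summable.of_nonneg_of_le (fun n => ?_) (fun n => ?_)
      (((Real.summable_pow_div_factorial a).mul_left (Real.exp a * ((k + 1 : ℕ) : ℝ))).mul_right
        (k.factorial / (lam + mu) ^ (k + 1)))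
    · have := hr n
      positivity
    · have : lam + mu ≤ lam + mu + n * ν := le_add_of_nonneg_right (by positivity)
      gcongr
  have hexp : ∀ t, ∑' n, F n t = ((k + 1 : ℕ) : ℝ) * t ^ k *
      Real.exp (a * (1 - Real.exp (-ν * t)) - (lam + mu) * t) := fun t => by
    have h := NormedSpace.expSeries_div_hasSum_exp (-a * Real.exp (-ν * t))
    rw [← Real.exp_eq_exp_ℝ] at h
    have h' := h.mul_left (Real.exp a * ((k + 1 : ℕ) : ℝ) * t ^ k * Real.exp (-((lam + mu) * t)))
    have hterm : (fun n => F n t) = fun n : ℕ => Real.exp a * ((k + 1 : ℕ) : ℝ) * t ^ k *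
        Real.exp (-((lam + mu) * t)) * ((-a * Real.exp (-ν * t)) ^ n / n.factorial) := by
      funext n
      have : Real.exp (-((lam + mu + n * ν) * t)) =
          Real.exp (-((lam + mu) * t)) * Real.exp (-ν * t) ^ n := by
        rw [← Real.exp_nat_mul, ← Real.exp_add]
        ring_nf
      simp only [F, c, this, mul_pow]
      ring
    rw [hterm, h'.tsum_eq]
    have : a * (1 - Real.exp (-ν * t)) - (lam + mu) * t =
        a + -((lam + mu) * t) + -a * Real.exp (-ν * t) := by ring
    rw [this, Real.exp_add, Real.exp_add]
    ring
  simp only [← hexp]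
  rw [← integral_tsum_of_summable_integral_norm hF hsum, ← tsum_mul_left]
  refine tsum_congr fun n => ?_
  simp only [F]
  rw [integral_const_mul, integral_pow_mul_exp_neg_mul_Ioi (hr n) k, Nat.factorial_succ]
  simp only [c, neg_pow a]
  push_cast
  have := (hr n).ne'
  field_simp
end
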